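/- arXiv:1102.1278 — 3 statements merged into one kernel-verified Lean document; each statement's English description precedes it below -/
import Mathlib

section
/- The torsion subgroup of the quotient of ℤ⁷ by the subgroup generated by the vectors (2,−1,−1,−1,−1,−1,−1), (0,0,0,0,0,1,−1), (0,0,0,1,−1,0,0), (0,0,1,−1,0,0,0) and (0,1,−1,0,0,0,0) is isomorphic to ℤ/2ℤ. (This is the singularity type A₃ + 2A₁.) -/
theorem mem_span_aux (x : Fin 7 → ℤ) :
    x ∈ Submodule.span ℤ ({![2,-1,-1,-1,-1,-1,-1], ![0,0,0,0,0,1,-1], ![0,0,0,1,-1,0,0], ![0,0,1,-1,0,0,0], ![0,1,-1,0,0,0,0]} : Set (Fin 7 → ℤ)) ↔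
      (2 : ℤ) ∣ x 0 ∧ x 1 + x 2 + x 3 + x 4 + 2 * x 0 = 0 ∧ x 5 + x 6 + x 0 = 0 := by
  constructor
  · intro h
    simp only [Submodule.mem_span_insert, Submodule.mem_span_singleton] at h
    obtain ⟨a, _, ⟨b, _, ⟨c, _, ⟨d, _, ⟨e, rfl⟩, rfl⟩, rfl⟩, rfl⟩, rfl⟩ := h
    simp [Matrix.cons_val]
    constructor <;> ring
  · rintro ⟨⟨t, h0⟩, h1, h2⟩
    simp only [Submodule.mem_span_insert, Submodule.mem_span_singleton]
    refine ⟨t, _, ⟨x 5 + t, _, ⟨x 1 + x 2 + x 3 + 3 * t, _, ⟨x 1 + x 2 + 2 * t, _, ⟨x 1 + t, rfl⟩, rfl⟩, rfl⟩, rfl⟩, ?_⟩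
    funext i
    fin_cases i <;> simp [Matrix.cons_val] <;> linarith

theorem quotient_torsion_eq :
    Nonempty
      ((AddCommGroup.torsion
        ((Fin 7 → ℤ) ⧸ Submodule.span ℤ ({![2,-1,-1,-1,-1,-1,-1], ![0,0,0,0,0,1,-1], ![0,0,0,1,-1,0,0], ![0,0,1,-1,0,0,0], ![0,1,-1,0,0,0,0]} : Set (Fin 7 → ℤ)))) ≃+
        ZMod 2) := by
  have key := mem_span_aux
  generalize Submodule.span ℤ ({![2,-1,-1,-1,-1,-1,-1], ![0,0,0,0,0,1,-1], ![0,0,0,1,-1,0,0], ![0,0,1,-1,0,0,0], ![0,1,-1,0,0,0,0]} : Set (Fin 7 → ℤ)) = L at key ⊢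
  let f : (Fin 7 → ℤ) →ₗ[ℤ] ZMod 2 :=
    ((Int.castAddHom (ZMod 2)).toIntLinearMap).comp (LinearMap.proj 0)
  have hf : ∀ x, f x = ((x 0 : ℤ) : ZMod 2) := fun x => rfl
  have hL : L ≤ LinearMap.ker f := by
    intro x hx
    rw [LinearMap.mem_ker, hf]
    exact (ZMod.intCast_zmod_eq_zero_iff_dvd _ 2).2 ((key x).1 hx).1
  let φ : AddCommGroup.torsion ((Fin 7 → ℤ) ⧸ L) →+ ZMod 2 :=
    (L.liftQ f hL).toAddMonoidHom.comp (AddSubgroup.subtype _)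
  refine ⟨AddEquiv.ofBijective φ ⟨?_, ?_⟩⟩
  · rw [injective_iff_map_eq_zero]
    rintro ⟨q, hq⟩ h
    obtain ⟨x, rfl⟩ := Submodule.Quotient.mk_surjective L q
    have h' : ((x 0 : ℤ) : ZMod 2) = 0 := h
    have h0 := (ZMod.intCast_zmod_eq_zero_iff_dvd _ 2).1 h'
    obtain ⟨n, hn, hx⟩ := isOfFinAddOrder_iff_nsmul_eq_zero.1 hq
    rw [← Submodule.Quotient.mk_smul, Submodule.Quotient.mk_eq_zero, key] at hx
    obtain ⟨-, h1, h2⟩ := hx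
    simp only [Pi.smul_apply, nsmul_eq_mul] at h1 h2
    have hn' : (n : ℤ) ≠ 0 := by positivity
    apply Subtype.ext
    change Submodule.Quotient.mk x = 0
    rw [Submodule.Quotient.mk_eq_zero, key]
    refine ⟨h0, mul_left_cancel₀ hn' ?_, mul_left_cancel₀ hn' ?_⟩ <;> linarith
  · have ht : (Submodule.Quotient.mk ![1,-2,0,0,0,-1,0] : (Fin 7 → ℤ) ⧸ L) ∈
        AddCommGroup.torsion ((Fin 7 → ℤ) ⧸ L) := by
      refine isOfFinAddOrder_iff_nsmul_eq_zero.2 ⟨2, by norm_num, ?_⟩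
      rw [← Submodule.Quotient.mk_smul, Submodule.Quotient.mk_eq_zero, key]
      simp [Matrix.cons_val]
    intro z
    have hz : z = 0 ∨ z = 1 := by revert z; decide
    rcases hz with rfl | rfl
    · exact ⟨0, map_zero _⟩
    · refine ⟨⟨_, ht⟩, ?_⟩
      change (((![1,-2,0,0,0,-1,0] : Fin 7 → ℤ) 0 : ℤ) : ZMod 2) = 1
      simp
end

section
/- Let V ⊂ P³ be a cubic surface over the finite field F_q. Suppose that in every equivalence class of V^reg(F_q) there is a point not contained in any line lying on V, that the Mordell–Weil group MW(V) has exactly 2 elements, and that the points of V^reg(F_q) are not all contained in a single plane. Then V^reg(F_q) decomposes into exactly two equivalence classes M₀ and M₁, and their cardinalities satisfy #M₁ − #M₀ = q or #M₁ − #M₀ = −q. -/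
open MvPolynomial FreeAbelianGroup

noncomputable section

/-- Points of `P³` over `K`. -/
abbrev Pt (K : Type*) [Field K] := Projectivization K (Fin 4 → K)

variable (K : Type*) [Field K] (P : MvPolynomial (Fin 4) K)

/-- The smooth (= non-singular) `K`-rational points of the surface `P = 0`:
points where `P` vanishes but its gradient does not. -/
def Reg := {p : Pt K // eval p.rep P = 0 ∧ ∃ i, eval p.rep (pderiv i P) ≠ 0}

/-- The binary cubic form obtained by restricting `P` to the line spanned by `a`, `b`. -/
def linePoly (a b : Fin 4 → K) : MvPolynomial (Fin 2) K :=
  aeval (fun j => C (a j) * X 0 + C (b j) * X 1) P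

/-- The collinearity relation: there is a line (spanned by the linearly independent
vectors `a`, `b`), not contained in the surface, whose intersection cycle with the
surface is `pts 0 + pts 1 + pts 2`; this is encoded by the factorization of the binary
cubic form obtained by restricting `P` to the line into the three linear forms
corresponding to the parameters `(s i, t i)` of the three points, with a nonzero
constant `c`. -/
def Col (pts : Fin 3 → Pt K) : Prop :=
  ∃ a b : Fin 4 → K, LinearIndependent K ![a, b] ∧
    ∃ c : K, c ≠ 0 ∧ ∃ s t : Fin 3 → K,
      (∀ i, ∃ h : s i • a + t i • b ≠ 0, Projectivization.mk K _ h = pts i) ∧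
      linePoly K P a b =
        C c * ∏ i : Fin 3,
          (C (t i) * (X 0 : MvPolynomial (Fin 2) K) - C (s i) * X 1)

/-- `x` lies on a line which is entirely contained in the surface `P = 0`. -/
def OnLineInV (x : Pt K) : Prop :=
  ∃ a b : Fin 4 → K, LinearIndependent K ![a, b] ∧ linePoly K P a b = 0 ∧
    ∃ (u v : K) (h : u • a + v • b ≠ 0), Projectivization.mk K _ h = x

/-- The relations defining the Mordell-Weil group. -/
def RelSet : Set (FreeAbelianGroup (Reg K P)) :=
  {g | ∃ x y : Fin 3 → Reg K P,
        Col K P (fun i => (x i).1) ∧ Col K P (fun i => (y i).1) ∧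
        g = of (x 0) + of (x 1) + of (x 2) - of (y 0) - of (y 1) - of (y 2)}

/-- The subgroup `N` of relations inside the free abelian group on the smooth points. -/
def Nsub : AddSubgroup (FreeAbelianGroup (Reg K P)) :=
  AddSubgroup.closure (RelSet K P)

/-- The augmentation homomorphism `ℤ[V^reg(K)] → ℤ`. -/
def aug : FreeAbelianGroup (Reg K P) →+ ℤ :=
  FreeAbelianGroup.lift fun _ => (1 : ℤ)

/-- The Mordell-Weil group of the surface: the kernel of the augmentation map on
`ℤ[V^reg(K)]/N`, realized as the image in the quotient of the degree-zero part of the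
free abelian group. -/
def MW : AddSubgroup (FreeAbelianGroup (Reg K P) ⧸ Nsub K P) :=
  (aug K P).ker.map (QuotientAddGroup.mk' (Nsub K P))

/-- Two smooth points are equivalent when `[x] - [y]` vanishes in `ℤ[V^reg(K)]/N`. -/
def EquivPt (x y : Reg K P) : Prop :=
  FreeAbelianGroup.of x - FreeAbelianGroup.of y ∈ Nsub K P

end

section helpers

variable {K : Type*} [Field K] {P : MvPolynomial (Fin 4) K}

/-- binary cubic form -/
noncomputable def bform (c0 c1 c2 c3 : K) : MvPolynomial (Fin 2) K :=
  C c0 * X 0 ^ 3 + C c1 * (X 0 ^ 2 * X 1) + C c2 * (X 0 * X 1 ^ 2) + C c3 * X 1 ^ 3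

lemma bform_inj {c0 c1 c2 c3 d0 d1 d2 d3 : K}
    (h : bform c0 c1 c2 c3 = bform d0 d1 d2 d3) : c0 = d0 ∧ c1 = d1 ∧ c2 = d2 ∧ c3 = d3 := by
  have h' := congrArg (aeval (![Polynomial.X, 1] : Fin 2 → Polynomial K)) h
  simp only [bform, map_add, map_mul, map_pow, aeval_X, Matrix.cons_val_zero,
    Matrix.cons_val_one, one_pow, mul_one, ← algebraMap_eq, AlgHom.commutes,
    Polynomial.algebraMap_eq] at h'
  refine ⟨?_, ?_, ?_, ?_⟩
  · simpa [Polynomial.coeff_X, Polynomial.coeff_X_pow, Polynomial.coeff_C] using congrArg (fun p => Polynomial.coeff p 3) h'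
  · simpa [Polynomial.coeff_X, Polynomial.coeff_X_pow, Polynomial.coeff_C] using congrArg (fun p => Polynomial.coeff p 2) h'
  · simpa [Polynomial.coeff_X, Polynomial.coeff_X_pow, Polynomial.coeff_C] using congrArg (fun p => Polynomial.coeff p 1) h'
  · simpa [Polynomial.coeff_X, Polynomial.coeff_X_pow, Polynomial.coeff_C] using congrArg (fun p => Polynomial.coeff p 0) h'

lemma bform_exists (Q : MvPolynomial (Fin 2) K) (h : Q.IsHomogeneous 3) :
    ∃ c0 c1 c2 c3 : K, Q = bform c0 c1 c2 c3 := by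
  classical
  have key : ∀ d : Fin 2 →₀ ℕ, d.degree = 3 → ∀ c : K, ∃ c0 c1 c2 c3 : K,
      monomial d c = bform c0 c1 c2 c3 := by
    intro d hd c
    have h2 : d 0 + d 1 = 3 := by
      rw [Finsupp.degree_eq_sum] at hd
      simpa [Fin.sum_univ_two] using hd
    have h0 : d 0 = 0 ∨ d 0 = 1 ∨ d 0 = 2 ∨ d 0 = 3 := by omega
    have e : monomial d c = C c * (X 0 ^ d 0 * X 1 ^ d 1) := by
      rw [monomial_eq, Finsupp.prod_fintype _ _ (by simp)]
      simp [Fin.prod_univ_two]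
    rcases h0 with h0 | h0 | h0 | h0
    · refine ⟨0, 0, 0, c, ?_⟩
      rw [e, h0, show d 1 = 3 by omega]; simp [bform]
    · refine ⟨0, 0, c, 0, ?_⟩
      rw [e, h0, show d 1 = 2 by omega]; simp [bform]
    · refine ⟨0, c, 0, 0, ?_⟩
      rw [e, h0, show d 1 = 1 by omega]; simp [bform]
    · refine ⟨c, 0, 0, 0, ?_⟩
      rw [e, h0, show d 1 = 0 by omega]; simp [bform]
  rw [Q.as_sum]
  refine Finset.sum_induction _ (fun R => ∃ c0 c1 c2 c3 : K, R = bform c0 c1 c2 c3) ?_ ?_ ?_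
  · rintro _ _ ⟨a0, a1, a2, a3, rfl⟩ ⟨b0, b1, b2, b3, rfl⟩
    refine ⟨a0 + b0, a1 + b1, a2 + b2, a3 + b3, ?_⟩
    simp only [bform, map_add]; ring
  · exact ⟨0, 0, 0, 0, by simp [bform]⟩
  · intro d hd
    apply key
    have := h (mem_support_iff.mp hd)
    rw [Finsupp.degree_eq_weight_one]; exact this

lemma linePoly_hom (hhom : P.IsHomogeneous 3) (a b : Fin 4 → K) :
    (linePoly K P a b).IsHomogeneous 3 := by
  have := hhom.aeval (fun j => (C (a j) * X 0 + C (b j) * X 1 : MvPolynomial (Fin 2) K)) 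
    (n := 1) (fun j => by
      apply IsHomogeneous.add
      · simpa using (isHomogeneous_C (Fin 2) (a j)).mul (isHomogeneous_X K (0 : Fin 2))
      · simpa using (isHomogeneous_C (Fin 2) (b j)).mul (isHomogeneous_X K (1 : Fin 2)))
  simpa [linePoly] using this

lemma linePoly_sub (a b : Fin 4 → K) (α β γ δ : K) :
    linePoly K P (α • a + β • b) (γ • a + δ • b) =
      aeval (![C α * X 0 + C γ * X 1, C β * X 0 + C δ * X 1] : Fin 2 → MvPolynomial (Fin 2) K)
        (linePoly K P a b) := by
  unfold linePoly
  induction P using MvPolynomial.induction_on with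
  | C c => simp [← algebraMap_eq]
  | add p q hp hq => rw [map_add, map_add, map_add, hp, hq]
  | mul_X p i hp =>
    rw [map_mul, map_mul, map_mul, hp]
    congr 1
    simp only [aeval_X, map_add, map_mul, ← algebraMap_eq, AlgHom.commutes]
    simp
    ring

lemma linePoly_eval (a b : Fin 4 → K) (s t : K) :
    eval ![s, t] (linePoly K P a b) = eval (s • a + t • b) P := by
  unfold linePoly
  induction P using MvPolynomial.induction_on with
  | C c => simp [← algebraMap_eq]
  | add p q hp hq => rw [map_add, map_add, map_add, hp, hq]
  | mul_X p i hp =>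
    rw [map_mul, map_mul, map_mul, hp]
    congr 1
    simp
    ring

/-- polar form -/
noncomputable def polar (P : MvPolynomial (Fin 4) K) (v w : Fin 4 → K) : K :=
  ∑ i, w i * eval v (pderiv i P)

lemma linePoly_pderiv (a b : Fin 4 → K) :
    eval ![1, 0] (pderiv 1 (linePoly K P a b)) = polar P a b := by
  have h1 : ∀ Q : MvPolynomial (Fin 4) K, eval ![1, 0] (linePoly K Q a b) = eval a Q := by
    intro Q; rw [linePoly_eval]; simp
  unfold polar
  induction P using MvPolynomial.induction_on with
  | C c => simp [linePoly, ← algebraMap_eq]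
  | add p q hp hq =>
    have : linePoly K (p + q) a b = linePoly K p a b + linePoly K q a b := by simp [linePoly]
    rw [this, map_add, map_add, hp, hq, ← Finset.sum_add_distrib]
    simp [mul_add]
  | mul_X p i hp =>
    have : linePoly K (p * X i) a b = linePoly K p a b * (C (a i) * X 0 + C (b i) * X 1) := by
      simp [linePoly]
    rw [this, Derivation.leibniz, map_add, smul_eq_mul, smul_eq_mul, map_mul, map_mul, hp, h1]
    simp [Derivation.leibniz, pderiv_X, mul_add, Finset.sum_add_distrib, Finset.mul_sum,
      Pi.single_apply]
    simp [apply_ite (eval a)]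
    rw [mul_comm]
    congr 1
    exact Finset.sum_congr rfl fun j _ => by ring


lemma line_ex (hhom : P.IsHomogeneous 3) (a b : Fin 4 → K) :
    ∃ c, linePoly K P a b = bform (eval a P) (polar P a b) c (eval b P) := by
  obtain ⟨c0, c1, c2, c3, h⟩ := bform_exists _ (linePoly_hom hhom a b)
  have e0 := linePoly_eval (P := P) a b 1 0
  have e3 := linePoly_eval (P := P) a b 0 1
  have e1 := linePoly_pderiv (P := P) a b
  rw [h] at e0 e1 e3
  simp [bform] at e0 e3
  simp [bform, pderiv_X, Derivation.leibniz] at e1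
  exact ⟨c2, by rw [h, e0, e1, e3]⟩

open Classical in
/-- second coefficient -/
noncomputable def cc (P : MvPolynomial (Fin 4) K) (a b : Fin 4 → K) : K :=
  if h : ∃ c, linePoly K P a b = bform (eval a P) (polar P a b) c (eval b P) then h.choose else 0

lemma line_eq (hhom : P.IsHomogeneous 3) (a b : Fin 4 → K) :
    linePoly K P a b = bform (eval a P) (polar P a b) (cc P a b) (eval b P) := by
  have h := line_ex hhom a b
  rw [cc, dif_pos h]
  exact h.choose_spec

lemma subst_coeffs (hhom : P.IsHomogeneous 3) (a b : Fin 4 → K) (α β γ δ : K) :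
    eval (α • a + β • b) P = eval a P * α ^ 3 + polar P a b * (α ^ 2 * β)
      + cc P a b * (α * β ^ 2) + eval b P * β ^ 3 ∧
    polar P (α • a + β • b) (γ • a + δ • b) = 3 * eval a P * α ^ 2 * γ
      + polar P a b * (2 * α * γ * β + α ^ 2 * δ)
      + cc P a b * (γ * β ^ 2 + 2 * α * β * δ) + 3 * eval b P * β ^ 2 * δ ∧
    cc P (α • a + β • b) (γ • a + δ • b) = 3 * eval a P * α * γ ^ 2
      + polar P a b * (γ ^ 2 * β + 2 * α * γ * δ)
      + cc P a b * (2 * γ * β * δ + α * δ ^ 2) + 3 * eval b P * β * δ ^ 2 := by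
  have h := linePoly_sub (P := P) a b α β γ δ
  rw [line_eq hhom, line_eq hhom a b] at h
  have h2 := bform_inj (h.trans (b := _) (c := bform
    (eval a P * α ^ 3 + polar P a b * (α ^ 2 * β)
      + cc P a b * (α * β ^ 2) + eval b P * β ^ 3)
    (3 * eval a P * α ^ 2 * γ
      + polar P a b * (2 * α * γ * β + α ^ 2 * δ)
      + cc P a b * (γ * β ^ 2 + 2 * α * β * δ) + 3 * eval b P * β ^ 2 * δ)
    (3 * eval a P * α * γ ^ 2
      + polar P a b * (γ ^ 2 * β + 2 * α * γ * δ)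
      + cc P a b * (2 * γ * β * δ + α * δ ^ 2) + 3 * eval b P * β * δ ^ 2)
    (eval a P * γ ^ 3 + polar P a b * (γ ^ 2 * δ)
      + cc P a b * (γ * δ ^ 2) + eval b P * δ ^ 3)) (by
    simp only [bform, map_add, map_mul, map_pow, aeval_X, ← algebraMap_eq, AlgHom.commutes,
      Matrix.cons_val_zero, Matrix.cons_val_one, map_ofNat]
    ring))
  exact ⟨h2.1, h2.2.1, h2.2.2.1⟩

lemma eval_scale (hhom : P.IsHomogeneous 3) (v : Fin 4 → K) (c : K) :
    eval (c • v) P = c ^ 3 * eval v P := by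
  have := (subst_coeffs hhom v 0 c 0 0 0).1
  simp at this
  rw [this]; ring

lemma polar_scale (hhom : P.IsHomogeneous 3) (v w : Fin 4 → K) (c : K) :
    polar P (c • v) w = c ^ 2 * polar P v w := by
  have := (subst_coeffs hhom v w c 0 0 1).2.1
  simp at this
  rw [this]; ring

lemma reg_of (hhom : P.IsHomogeneous 3) (v w : Fin 4 → K) (hv : eval v P = 0)
    (hw : polar P v w ≠ 0) (h0 : v ≠ 0) : ∃ y : Reg K P, y.1 = Projectivization.mk K v h0 := by
  obtain ⟨c, hc⟩ := Projectivization.exists_smul_eq_mk_rep K v h0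
  refine ⟨⟨Projectivization.mk K v h0, ?_, ?_⟩, rfl⟩
  · rw [← hc, Units.smul_def, eval_scale hhom, hv, mul_zero]
  · by_contra! hcon
    have : polar P (Projectivization.mk K v h0).rep w = 0 := by
      simp [polar, hcon]
    rw [← hc, Units.smul_def, polar_scale hhom] at this
    simp [hw] at this

lemma col_two (hhom : P.IsHomogeneous 3) (a b : Fin 4 → K) (hab : LinearIndependent K ![a, b])
    (ha : eval a P = 0) (hb : eval b P = 0) (pts : Fin 3 → Pt K)
    (ha0 : a ≠ 0) (hb0 : b ≠ 0) (hz0 : -cc P a b • a + polar P a b • b ≠ 0)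
    (h0 : pts 0 = Projectivization.mk K a ha0) (h1 : pts 1 = Projectivization.mk K b hb0)
    (h2 : pts 2 = Projectivization.mk K _ hz0) : Col K P pts := by
  refine ⟨a, b, hab, -1, by simp, ![1, 0, -cc P a b], ![0, 1, polar P a b], ?_, ?_⟩
  · intro i
    fin_cases i
    · refine ⟨by simpa using ha0, ?_⟩
      simp [h0]
    · refine ⟨by simpa using hb0, ?_⟩
      simp [h1]
    · refine ⟨by simpa using hz0, ?_⟩
      simp [h2]
  · rw [line_eq hhom, ha, hb]
    simp [bform, Fin.prod_univ_three]
    ring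

lemma col_three (hhom : P.IsHomogeneous 3) (a b : Fin 4 → K) (hab : LinearIndependent K ![a, b])
    (ha : eval a P = 0) (hb : eval b P ≠ 0) (h1 : polar P a b = 0) (h2 : cc P a b = 0)
    (ha0 : a ≠ 0) : Col K P (fun _ => Projectivization.mk K a ha0) := by
  refine ⟨a, b, hab, -eval b P, by simpa using hb, fun _ => 1, fun _ => 0, ?_, ?_⟩
  · intro i
    refine ⟨by simpa using ha0, ?_⟩
    simp
  · rw [line_eq hhom, ha, h1, h2]
    simp [bform]
    ring

end helpers

section mw
variable {K : Type*} [Field K] {P : MvPolynomial (Fin 4) K}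

lemma mw_char (hMW : Nat.card ↥(MW K P) = 2) :
    ∃ f : Reg K P → ℤ, (∀ x, f x = 1 ∨ f x = -1) ∧ (∀ x y, EquivPt K P x y ↔ f x = f y) ∧
      (∃ x, f x = 1) ∧ (∃ x, f x = -1) ∧
      (∀ x : Fin 3 → Reg K P, Col K P (fun i => (x i).1) → f (x 0) * f (x 1) * f (x 2) = 1) := by
  classical
  set π := QuotientAddGroup.mk' (Nsub K P) with hπ
  have hequiv : ∀ x y, EquivPt K P x y ↔ π (of x) = π (of y) := by
    intro x y
    rw [EquivPt, ← sub_eq_zero, ← map_sub]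
    exact (QuotientAddGroup.eq_zero_iff _).symm
  have hne : ∃ x y : Reg K P, π (of x) ≠ π (of y) := by
    by_contra! hcon
    have hz : ∀ g : FreeAbelianGroup (Reg K P), aug K P g = 0 → π g = 0 := by
      intro g hg
      rcases isEmpty_or_nonempty (Reg K P) with he | ⟨⟨x0⟩⟩
      · rw [Subsingleton.elim g 0, map_zero]
      · have : ∀ g, π g = aug K P g • π (of x0) := by
          intro g
          have : π = ((zmultiplesHom _ (π (of x0))).comp (aug K P)) := by
            apply FreeAbelianGroup.lift_ext
            intro x
            simp [aug, hcon x x0]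
          conv_lhs => rw [this]
          simp
        rw [this, hg, zero_smul]
    have : Subsingleton (MW K P) := by
      refine ⟨fun u v => ?_⟩
      have : ∀ w : MW K P, w = 0 := by
        rintro ⟨w, g, hg, rfl⟩
        ext
        exact hz g hg
      rw [this u, this v]
    rw [Nat.card_eq_one_iff_unique.mpr ⟨this, ⟨0⟩⟩] at hMW
    omega
  obtain ⟨x0, x1, h01⟩ := hne
  have hd : ∀ x y, π (of x) - π (of y) ∈ MW K P := by
    intro x y
    refine ⟨of x - of y, ?_, by simp [hπ]⟩
    show aug K P _ = 0
    simp [aug]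
  have huniq : ∀ u v : FreeAbelianGroup (Reg K P) ⧸ Nsub K P, u ∈ MW K P → v ∈ MW K P →
      u ≠ 0 → v ≠ 0 → u = v := by
    intro u v hu hv hu0 hv0
    obtain ⟨p, q, hpq, hall⟩ := Nat.card_eq_two_iff.mp hMW
    have h : ∀ w : MW K P, w = p ∨ w = q := fun w => by
      have : w ∈ ({p, q} : Set _) := by rw [hall]; trivial
      simpa using this
    have hu' : (⟨u, hu⟩ : MW K P) ≠ 0 := fun h => hu0 (congrArg Subtype.val h)
    have hv' : (⟨v, hv⟩ : MW K P) ≠ 0 := fun h => hv0 (congrArg Subtype.val h)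
    have : (⟨u, hu⟩ : MW K P) = ⟨v, hv⟩ := by
      rcases h ⟨u, hu⟩ with a | a <;> rcases h ⟨v, hv⟩ with b | b <;> rcases h 0 with c | c <;>
        simp_all
    exact congrArg Subtype.val this
  let ψ : FreeAbelianGroup (Reg K P) ⧸ Nsub K P → ℤ := fun g => if g = 0 then 1 else -1
  have hψ : ∀ u v, u ∈ MW K P → v ∈ MW K P → ψ (u + v) = ψ u * ψ v := by
    intro u v hu hv
    by_cases hu0 : u = 0
    · simp [ψ, hu0]
    by_cases hv0 : v = 0
    · simp [ψ, hv0]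
    have : u + v = 0 := by
      rw [huniq u (-v) hu (neg_mem hv) hu0 (by simpa using hv0)]; simp
    simp [ψ, this, hu0, hv0]
  let χ : Reg K P → ℤ := fun x => ψ (π (of x) - π (of x0))
  have hχ1 : ∀ x, χ x = 1 ∨ χ x = -1 := by
    intro x; simp only [χ, ψ]; split_ifs <;> simp
  have hχe : ∀ x y, EquivPt K P x y ↔ χ x = χ y := by
    intro x y
    rw [hequiv]
    constructor
    · intro h; simp only [χ, h]
    · intro h
      by_cases hx : π (of x) - π (of x0) = 0 <;> by_cases hy : π (of y) - π (of x0) = 0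
      · rw [sub_eq_zero.mp hx, sub_eq_zero.mp hy]
      · simp [χ, ψ, hx, hy] at h
      · simp [χ, ψ, hx, hy] at h
      · exact sub_left_injective (huniq _ _ (hd _ _) (hd _ _) hx hy)
  have hχ0 : χ x0 = 1 := by simp [χ, ψ]
  have hχ11 : χ x1 = -1 := by
    have : π (of x1) - π (of x0) ≠ 0 := fun h => h01 (sub_eq_zero.mp h).symm
    simp [χ, ψ, this]
  have hprod : ∀ x : Fin 3 → Reg K P, χ (x 0) * χ (x 1) * χ (x 2) =
      ψ (π (of (x 0) + of (x 1) + of (x 2)) - 3 • π (of x0)) := by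
    intro x
    simp only [χ]
    rw [← hψ _ _ (hd _ _) (hd _ _), ← hψ _ _ (add_mem (hd _ _) (hd _ _)) (hd _ _)]
    congr 1
    simp only [map_add]
    abel
  have hcol : ∀ x y : Fin 3 → Reg K P, Col K P (fun i => (x i).1) → Col K P (fun i => (y i).1) →
      χ (x 0) * χ (x 1) * χ (x 2) = χ (y 0) * χ (y 1) * χ (y 2) := by
    intro x y hx hy
    rw [hprod, hprod]
    congr 2
    rw [← sub_eq_zero, ← map_sub]
    refine (QuotientAddGroup.eq_zero_iff _).mpr (AddSubgroup.subset_closure ⟨x, y, hx, hy, ?_⟩)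
    abel
  have hκ : ∃ κ : ℤ, (κ = 1 ∨ κ = -1) ∧ ∀ x : Fin 3 → Reg K P, Col K P (fun i => (x i).1) →
      χ (x 0) * χ (x 1) * χ (x 2) = κ := by
    by_cases h : ∃ y : Fin 3 → Reg K P, Col K P (fun i => (y i).1)
    · obtain ⟨y, hy⟩ := h
      refine ⟨_, ?_, fun x hx => hcol x y hx hy⟩
      rcases hχ1 (y 0) with a | a <;> rcases hχ1 (y 1) with b | b <;>
        rcases hχ1 (y 2) with c | c <;> simp [a, b, c]
    · exact ⟨1, Or.inl rfl, fun x hx => (h ⟨x, hx⟩).elim⟩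
  obtain ⟨κ, hκ1, hκc⟩ := hκ
  refine ⟨fun x => κ * χ x, ?_, ?_, ?_, ?_, ?_⟩
  · intro x
    rcases hκ1 with a | a <;> rcases hχ1 x with b | b <;> simp [a, b]
  · intro x y
    rw [hχe]
    rcases hκ1 with a | a <;> simp [a]
  · rcases hκ1 with a | a
    · exact ⟨x0, by simp [a, hχ0]⟩
    · exact ⟨x1, by simp [a, hχ11]⟩
  · rcases hκ1 with a | a
    · exact ⟨x1, by simp [a, hχ11]⟩
    · exact ⟨x0, by simp [a, hχ0]⟩
  · intro x hx
    have := hκc x hx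
    calc _ = κ ^ 3 * (χ (x 0) * χ (x 1) * χ (x 2)) := by ring
      _ = 1 := by rw [this]; rcases hκ1 with a | a <;> simp [a]

end mw

section count
variable {K : Type*} [Field K] {P : MvPolynomial (Fin 4) K}

lemma li_ne0 {a b : Fin 4 → K} (h : LinearIndependent K ![a, b]) {s t : K} (hst : s ≠ 0 ∨ t ≠ 0) :
    s • a + t • b ≠ 0 := by
  intro h0
  have := LinearIndependent.pair_iff.mp h s t h0
  tauto

lemma li_of_ne (x y : Pt K) (h : y ≠ x) : LinearIndependent K ![x.rep, y.rep] := by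
  rw [LinearIndependent.pair_iff' x.rep_nonzero]
  intro c hc
  apply h
  rw [← x.mk_rep, ← y.mk_rep, Projectivization.mk_eq_mk_iff']
  exact ⟨c, hc⟩

/-- polar as linear map -/
noncomputable def polarL (P : MvPolynomial (Fin 4) K) (a : Fin 4 → K) : (Fin 4 → K) →ₗ[K] K where
  toFun b := polar P a b
  map_add' u v := by simp [polar, add_mul, Finset.sum_add_distrib]
  map_smul' c u := by simp [polar, mul_assoc, Finset.mul_sum]

lemma tangent_count [Fintype K] (hhom : P.IsHomogeneous 3) (x : Reg K P)
    (hB : ∀ b, LinearIndependent K ![x.1.rep, b] → polar P x.1.rep b = 0 → cc P x.1.rep b ≠ 0) :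
    Nat.card {y : Reg K P // y ≠ x ∧ polar P x.1.rep y.1.rep = 0} = Fintype.card K + 1 := by
  set a := x.1.rep with ha
  have ha0 : a ≠ 0 := x.1.rep_nonzero
  have hFa : eval a P = 0 := x.2.1
  have haa : polar P a a = 0 := by
    have := (subst_coeffs hhom a 0 1 0 1 0).2.1
    simpa [hFa] using this
  let W := LinearMap.ker (polarL P a)
  have hmem : ∀ b, b ∈ W ↔ polar P a b = 0 := fun b => Iff.rfl
  let aW : W := ⟨a, haa⟩
  have haW : aW ≠ 0 := fun h => ha0 (congrArg Subtype.val h)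
  let S := Submodule.span K {aW}
  have hL : polarL P a ≠ 0 := by
    obtain ⟨i, hi⟩ := x.2.2
    intro h
    apply hi
    have := LinearMap.congr_fun h (Pi.single i 1)
    simpa [polarL, polar, Pi.single_apply] using this
  have hW : Module.finrank K W + 1 = 4 := by
    rw [Module.Dual.finrank_ker_add_one_of_ne_zero hL]; simp
  have hQ : Module.finrank K (W ⧸ S) = 2 := by
    have h1 := S.finrank_quotient_add_finrank
    have h2 : Module.finrank K S = 1 := finrank_span_singleton haW
    omega
  have hli : ∀ w : W, S.mkQ w ≠ 0 → LinearIndependent K ![a, w.1] := by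
    intro w hw
    rw [LinearIndependent.pair_iff' ha0]
    intro c hc
    apply hw
    rw [Submodule.mkQ_apply, Submodule.Quotient.mk_eq_zero, Submodule.mem_span_singleton]
    exact ⟨c, Subtype.ext hc⟩
  have hne : ∀ y : {y : Reg K P // y ≠ x ∧ polar P a y.1.rep = 0},
      S.mkQ ⟨y.1.1.rep, y.2.2⟩ ≠ 0 := by
    intro y h
    rw [Submodule.mkQ_apply, Submodule.Quotient.mk_eq_zero, Submodule.mem_span_singleton] at h
    obtain ⟨c, hc⟩ := h
    have h1 := li_of_ne x.1 y.1.1 (fun h => y.2.1 (Subtype.ext h))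
    rw [LinearIndependent.pair_iff' ha0] at h1
    exact h1 c (congrArg Subtype.val hc)
  let g : {y : Reg K P // y ≠ x ∧ polar P a y.1.rep = 0} → Projectivization K (W ⧸ S) :=
    fun y => Projectivization.mk K _ (hne y)
  have hg : Function.Bijective g := by
    constructor
    · intro y z hyz
      obtain ⟨c, hc⟩ := (Projectivization.mk_eq_mk_iff' K _ _ _ _).mp hyz
      rw [← map_smul, ← sub_eq_zero, ← map_sub, Submodule.mkQ_apply,
        Submodule.Quotient.mk_eq_zero, Submodule.mem_span_singleton] at hc
      obtain ⟨d, hd⟩ := hc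
      have hd : d • a = c • z.1.1.rep - y.1.1.rep := congrArg Subtype.val hd
      have hy : y.1.1.rep = (-d) • a + c • z.1.1.rep := by rw [neg_smul, hd]; abel
      have hz := li_of_ne x.1 z.1.1 (fun h => z.2.1 (Subtype.ext h))
      have e := (subst_coeffs hhom a z.1.1.rep (-d) c 0 0).1
      rw [← hy, y.1.2.1, hFa, z.2.2, z.1.2.1] at e
      have hcc := hB _ hz z.2.2
      have hc0 : c ≠ 0 := by
        rintro rfl
        have hyl := li_of_ne x.1 y.1.1 (fun h => y.2.1 (Subtype.ext h))
        rw [LinearIndependent.pair_iff' ha0] at hyl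
        exact hyl (-d) (by rw [hy]; simp [ha])
      have hd0 : d = 0 := by
        have : cc P a z.1.1.rep * (d * c ^ 2) = 0 := by linear_combination e
        simpa [hcc, hc0] using this
      apply Subtype.ext; apply Subtype.ext
      rw [← y.1.1.mk_rep, ← z.1.1.mk_rep, Projectivization.mk_eq_mk_iff']
      exact ⟨c, by rw [hy, hd0]; simp⟩
    · intro p
      induction p using Projectivization.ind with | h v hv =>
      obtain ⟨w, rfl⟩ := S.mkQ_surjective v
      have hl := hli w hv
      have hw : polar P a w.1 = 0 := w.2
      have hb := hB _ hl hw
      set B := cc P a w.1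
      set D := eval w.1 P
      obtain ⟨e1, e2, -⟩ := subst_coeffs hhom a w.1 (-D) B 1 0
      rw [hFa, hw] at e1 e2
      have h0 : (-D) • a + B • w.1 ≠ 0 := li_ne0 hl (Or.inr hb)
      obtain ⟨y, hy⟩ := reg_of hhom ((-D) • a + B • w.1) ((1:K) • a + (0:K) • w.1)
        (by rw [e1]; ring) (by rw [e2]; ring_nf; exact mul_ne_zero (pow_ne_zero 2 hb) hb) h0
      obtain ⟨c, hc⟩ := Projectivization.exists_smul_eq_mk_rep K _ h0
      rw [← hy, Units.smul_def] at hc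
      have hyr : y.1.rep = (-(c * D)) • a + (c * B) • w.1 := by
        rw [← hc, smul_add, smul_smul, smul_smul]; simp
      have hc0 : (c : K) ≠ 0 := c.ne_zero
      have hyx : y ≠ x := by
        rintro rfl
        have h1 : (1 + c * D) • a + (-(c * B)) • w.1 = 0 := by
          have : a = (-(c * D)) • a + (c * B) • w.1 := hyr
          rw [add_smul, one_smul, neg_smul]
          nth_rewrite 1 [this]
          rw [neg_smul]; abel
        exact li_ne0 hl (Or.inr (by simp [hb])) h1
      have hyp : polar P a y.1.rep = 0 := by
        rw [← hmem, hyr]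
        exact add_mem (W.smul_mem _ haa) (W.smul_mem _ w.2)
      refine ⟨⟨y, hyx, hyp⟩, ?_⟩
      refine (Projectivization.mk_eq_mk_iff' K _ _ _ _).mpr ⟨c * B, ?_⟩
      rw [← map_smul, ← sub_eq_zero, ← map_sub, Submodule.mkQ_apply,
        Submodule.Quotient.mk_eq_zero, Submodule.mem_span_singleton]
      refine ⟨c * D, Subtype.ext ?_⟩
      show (c * D) • a = (c * B) • w.1 - y.1.rep
      rw [hyr, neg_smul]; abel
  rw [Nat.card_congr (Equiv.ofBijective g hg), Projectivization.card_of_finrank_two _ _ hQ,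
    Nat.card_eq_fintype_card]

lemma sum_eq [Fintype K] [Fintype (Reg K P)] (hhom : P.IsHomogeneous 3) (f : Reg K P → ℤ)
    (hf : ∀ x, f x = 1 ∨ f x = -1)
    (hcol : ∀ x : Fin 3 → Reg K P, Col K P (fun i => (x i).1) → f (x 0) * f (x 1) * f (x 2) = 1)
    (x : Reg K P) (hx : f x = -1) (hline : ¬ OnLineInV K P x.1) :
    ∑ y, f y = Fintype.card K := by
  classical
  set a := x.1.rep with ha
  have ha0 : a ≠ 0 := x.1.rep_nonzero
  have hFa : eval a P = 0 := x.2.1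
  have hxa : x.1 = Projectivization.mk K a ha0 := x.1.mk_rep.symm
  have haa : polar P a a = 0 := by
    have := (subst_coeffs hhom a 0 1 0 1 0).2.1
    simpa [hFa] using this
  have hB : ∀ b, LinearIndependent K ![a, b] → polar P a b = 0 → cc P a b ≠ 0 := by
    intro b hl hp hc
    by_cases hb : eval b P = 0
    · apply hline
      refine ⟨a, b, hl, ?_, 1, 0, by simpa using ha0, ?_⟩
      · rw [line_eq hhom, hFa, hp, hc, hb]; simp [bform]
      · simp [ha]
    · have := hcol (fun _ => x) (by
        have := col_three hhom a b hl hFa hb hp hc ha0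
        rwa [← hxa] at this)
      rw [hx] at this
      norm_num at this
  have hT := tangent_count hhom x hB
  have hlin : ∀ y : Reg K P, y ≠ x → LinearIndependent K ![a, y.1.rep] := fun y hy =>
    li_of_ne x.1 y.1 (fun h => hy (Subtype.ext h))
  have hcol2 : ∀ y z : Reg K P, y ≠ x →
      ∀ h : -cc P a y.1.rep • a + polar P a y.1.rep • y.1.rep ≠ 0,
      z.1 = Projectivization.mk K _ h → f x * f y * f z = 1 := by
    intro y z hy h hz
    exact hcol ![x, y, z] (col_two hhom a y.1.rep (hlin y hy) hFa y.2.1 _ ha0 y.1.rep_nonzero h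
      hxa y.1.mk_rep.symm hz)
  have hT1 : ∀ y : Reg K P, y ≠ x → polar P a y.1.rep = 0 → f y = 1 := by
    intro y hy hp
    have hb := hB _ (hlin y hy) hp
    have := hcol2 y x hy (li_ne0 (hlin y hy) (Or.inl (by simpa using hb))) (by
      rw [hxa, Projectivization.mk_eq_mk_iff']
      refine ⟨(-cc P a y.1.rep)⁻¹, ?_⟩
      rw [hp, zero_smul, add_zero, smul_smul, inv_mul_cancel₀ (by simpa using hb), one_smul])
    rw [hx] at this
    linarith
  have hNB : ∀ y : Reg K P, polar P a y.1.rep ≠ 0 → y ≠ x ∧ cc P a y.1.rep ≠ 0 := by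
    intro y hp
    have hy : y ≠ x := by rintro rfl; exact hp haa
    refine ⟨hy, fun hc => ?_⟩
    have := hcol2 y y hy (li_ne0 (hlin y hy) (Or.inr hp)) (by
      conv_lhs => rw [← y.1.mk_rep]
      rw [Projectivization.mk_eq_mk_iff']
      refine ⟨(polar P a y.1.rep)⁻¹, ?_⟩
      rw [hc, neg_zero, zero_smul, zero_add, smul_smul, inv_mul_cancel₀ hp, one_smul])
    rw [hx] at this
    rcases hf y with h | h <;> rw [h] at this <;> norm_num at this
  have hg : ∀ y : Reg K P, polar P a y.1.rep ≠ 0 → ∃ z : Reg K P, f y + f z = 0 ∧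
      ∃ c : K, c ≠ 0 ∧
        z.1.rep = c • (-cc P a y.1.rep • a + polar P a y.1.rep • y.1.rep) := by
    intro y hp
    obtain ⟨hy, hc⟩ := hNB y hp
    have h0 := li_ne0 (hlin y hy) (s := -cc P a y.1.rep) (Or.inr hp)
    obtain ⟨e1, e2, -⟩ := subst_coeffs hhom a y.1.rep (-cc P a y.1.rep) (polar P a y.1.rep) 1 0
    rw [hFa, y.2.1] at e1 e2
    obtain ⟨z, hz⟩ := reg_of hhom _ ((1:K) • a + (0:K) • y.1.rep)
      (by rw [e1]; ring) (by
        rw [e2]; ring_nf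
        simp [hc, hp]) h0
    refine ⟨z, ?_, ?_⟩
    · have := hcol2 y z hy h0 hz
      rw [hx] at this
      rcases hf y with h | h <;> rw [h] at this ⊢ <;> linarith
    · obtain ⟨c, hc⟩ := Projectivization.exists_smul_eq_mk_rep K _ h0
      exact ⟨c, c.ne_zero, by rw [hz, ← hc, Units.smul_def]⟩
  choose g hg1 hg2 using hg
  have hAB : ∀ y hp, ∃ c : K, c ≠ 0 ∧ polar P a (g y hp).1.rep = c * polar P a y.1.rep ^ 2 ∧
      cc P a (g y hp).1.rep = - c ^ 2 * polar P a y.1.rep ^ 2 * cc P a y.1.rep ∧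
      (g y hp).1.rep = c • (-cc P a y.1.rep • a + polar P a y.1.rep • y.1.rep) := by
    intro y hp
    obtain ⟨c, hc, hr⟩ := hg2 y hp
    obtain ⟨-, e1, e2⟩ := subst_coeffs hhom a y.1.rep 1 0
      (c * -cc P a y.1.rep) (c * polar P a y.1.rep)
    have : (c * -cc P a y.1.rep) • a + (c * polar P a y.1.rep) • y.1.rep = (g y hp).1.rep := by
      rw [hr, smul_add, smul_smul, smul_smul]
    rw [this, one_smul, zero_smul, add_zero] at e1 e2
    refine ⟨c, hc, ?_, ?_, hr⟩
    · rw [e1, hFa]; ring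
    · rw [e2, hFa]; ring
  have hN0 : ∑ y ∈ Finset.univ.filter (fun y : Reg K P => polar P a y.1.rep ≠ 0), f y = 0 := by
    have hgN : ∀ y hp, polar P a (g y hp).1.rep ≠ 0 := by
      intro y hp
      obtain ⟨c, hc, h, -⟩ := hAB y hp
      rw [h]; exact mul_ne_zero hc (pow_ne_zero 2 hp)
    refine Finset.sum_involution (fun y hy => g y (by simpa using hy)) ?_ ?_ ?_ ?_
    · intro y hy; exact hg1 y _
    · intro y hy h0 heq
      have := hg1 y (by simpa using hy)
      rw [heq] at this
      omega
    · intro y hy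
      simpa using hgN y _
    · intro y hy
      have hp : polar P a y.1.rep ≠ 0 := by simpa using hy
      obtain ⟨c, hc, h1, h2, h3⟩ := hAB y hp
      obtain ⟨d, hd, -, -, h4⟩ := hAB (g y hp) (hgN y hp)
      apply Subtype.ext
      show (g (g y hp) (hgN y hp)).1 = y.1
      rw [← (g (g y hp) (hgN y hp)).1.mk_rep, ← y.1.mk_rep, Projectivization.mk_eq_mk_iff']
      refine ⟨d * c ^ 2 * polar P a y.1.rep ^ 3, ?_⟩
      rw [h4, h2, h1, h3]
      simp only [smul_add, smul_smul]
      rw [← add_assoc, ← add_smul]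
      ring_nf
      simp
  have hsplit := Finset.sum_filter_add_sum_filter_not Finset.univ
    (fun y : Reg K P => polar P a y.1.rep ≠ 0) f
  rw [← hsplit, hN0, zero_add]
  have hset : Finset.univ.filter (fun y : Reg K P => ¬ polar P a y.1.rep ≠ 0) =
      insert x (Finset.univ.filter (fun y : Reg K P => y ≠ x ∧ polar P a y.1.rep = 0)) := by
    ext y
    simp only [Finset.mem_filter, Finset.mem_univ, true_and, Finset.mem_insert, not_not]
    by_cases h : y = x
    · subst h; simp [← ha, haa]
    · simp [h]
  rw [hset, Finset.sum_insert (by simp), hx,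
    Finset.sum_congr rfl (g := fun _ => (1 : ℤ)) (by
      intro y hy
      simp at hy
      exact hT1 y hy.1 hy.2)]
  rw [Nat.card_eq_fintype_card, Fintype.card_subtype] at hT
  rw [Finset.sum_const, hT]
  simp

end count

/-- let `V ⊂ P³` be a cubic surface over the finite field `F_q`.  Suppose
that every equivalence class of `V^reg(F_q)` contains a point lying on no line contained
in `V`, that `MW(V)` has exactly two elements, and that the points of `V^reg(F_q)` are
not all contained in a single plane.  Then `V^reg(F_q)` decomposes into exactly two
equivalence classes `M₀`, `M₁`, and `#M₁ - #M₀ = ±q`. -/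
theorem two_classes_difference_q (K : Type*) [Field K] [Fintype K]
    (P : MvPolynomial (Fin 4) K) (hP : P ≠ 0) (hhom : P.IsHomogeneous 3)
    (hrep : ∀ x : Reg K P, ∃ y : Reg K P, EquivPt K P x y ∧ ¬ OnLineInV K P y.1)
    (hMW : Nat.card ↥(MW K P) = 2)
    (hplane : ¬ ∃ l : (Fin 4 → K) →ₗ[K] K, l ≠ 0 ∧ ∀ x : Reg K P, l x.1.rep = 0) :
    ∃ M₀ M₁ : Set (Reg K P), M₀.Nonempty ∧ M₁.Nonempty ∧ Disjoint M₀ M₁ ∧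
      M₀ ∪ M₁ = Set.univ ∧
      (∀ x y : Reg K P,
        EquivPt K P x y ↔ ((x ∈ M₀ ∧ y ∈ M₀) ∨ (x ∈ M₁ ∧ y ∈ M₁))) ∧
      ((M₁.ncard : ℤ) - (M₀.ncard : ℤ) = (Fintype.card K : ℤ) ∨
        (M₁.ncard : ℤ) - (M₀.ncard : ℤ) = -(Fintype.card K : ℤ)) := by
  classical
  haveI : Finite (Reg K P) := Subtype.finite
  haveI := Fintype.ofFinite (Reg K P)
  obtain ⟨f, hf, he, ⟨u, hu⟩, ⟨v, hv⟩, hcol⟩ := mw_char hMW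
  obtain ⟨x, hvx, hx⟩ := hrep v
  have hs := sum_eq hhom f hf hcol x (by rw [← (he v x).mp hvx, hv]) hx
  refine ⟨{y | f y = 1}, {y | f y = -1}, ⟨u, hu⟩, ⟨v, hv⟩, ?_, ?_, ?_, Or.inr ?_⟩
  · rw [Set.disjoint_left]
    intro y h1 h2
    simp only [Set.mem_setOf_eq] at h1 h2
    omega
  · ext y
    simpa using hf y
  · intro y z
    rw [he]
    rcases hf y with h | h <;> rcases hf z with h' | h' <;> simp [h, h']
  · have key : ∀ y, f y = (if f y = 1 then 1 else 0) - (if f y = -1 then 1 else 0) := by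
      intro y
      rcases hf y with h | h <;> simp [h]
    rw [Finset.sum_congr rfl (fun y _ => key y), Finset.sum_sub_distrib, Finset.sum_boole,
      Finset.sum_boole] at hs
    rw [Set.ncard_eq_toFinset_card', Set.ncard_eq_toFinset_card', Set.toFinset_setOf,
      Set.toFinset_setOf]
    linarith
end

section
/- Let V ⊂ P³ be a cubic surface over the finite field F_q. Suppose that in every equivalence class of V^reg(F_q) there is a point not contained in any line lying on V, and that the Mordell–Weil group MW(V) has exactly 3 elements. Then V^reg(F_q) decomposes into exactly three equivalence classes M₀, M₁, M₂, and these have the same cardinality: #M₀ = #M₁ = #M₂. -/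
open MvPolynomial FreeAbelianGroup

section Aux
variable {K : Type*} [Field K] {P : MvPolynomial (Fin 4) K}

/-- directional derivative of `P` at `u` in direction `v` -/
noncomputable def DD (P : MvPolynomial (Fin 4) K) (u v : Fin 4 → K) : K :=
  ∑ i, v i * eval u (pderiv i P)

lemma eval_hom {n : ℕ} {Q : MvPolynomial (Fin 4) K} (hQ : Q.IsHomogeneous n) (c : K)
    (v : Fin 4 → K) : eval (c • v) Q = c ^ n * eval v Q := by
  rw [eval_eq, eval_eq, Finset.mul_sum]
  refine Finset.sum_congr rfl fun d hd => ?_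
  have h := hQ (mem_support_iff.mp hd)
  have h2 : ∑ i ∈ d.support, d i = n := by
    rw [← h]; simp [Finsupp.weight_apply, Finsupp.sum]
  simp only [Pi.smul_apply, smul_eq_mul, mul_pow, Finset.prod_mul_distrib,
    Finset.prod_pow_eq_pow_sum, h2]
  ring

lemma eval_linePoly (a b : Fin 4 → K) (p : Fin 2 → K) :
    eval p (linePoly K P a b) = eval (p 0 • a + p 1 • b) P := by
  unfold linePoly
  induction P using MvPolynomial.induction_on with
  | C r => simp
  | add f g hf hg => simp only [map_add, hf, hg]
  | mul_X f i hf => 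
    simp only [map_mul, hf, aeval_X, eval_X]
    simp; left; ring

lemma eval_pderiv_linePoly (a b : Fin 4 → K) (p q : Fin 2 → K) :
    q 0 * eval p (pderiv 0 (linePoly K P a b)) + q 1 * eval p (pderiv 1 (linePoly K P a b))
     = DD P (p 0 • a + p 1 • b) (q 0 • a + q 1 • b) := by
  induction P using MvPolynomial.induction_on with
  | C r => simp [linePoly, DD]
  | add f g hf hg => 
    have : linePoly K (f + g) a b = linePoly K f a b + linePoly K g a b := by simp [linePoly]
    rw [this]
    have h2 : ∀ u v, DD (f + g) u v = DD f u v + DD g u v := by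
      intro u v; simp [DD, mul_add, Finset.sum_add_distrib]
    rw [h2, ← hf, ← hg]; simp; ring
  | mul_X f i hf => 
    have : linePoly K (f * X i) a b = linePoly K f a b * (C (a i) * X 0 + C (b i) * X 1) := by
      simp [linePoly]
    rw [this]
    have h2 : ∀ u v, DD (f * X i) u v = DD f u v * u i + eval u f * v i := by
      intro u v
      simp only [DD, pderiv_mul, pderiv_X, map_add, map_mul, mul_add, Finset.sum_add_distrib,
        eval_X, Finset.sum_mul]
      congr 1
      · refine Finset.sum_congr rfl fun j _ => by ring
      · rw [Finset.sum_eq_single i]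
        · simp; ring
        · intro j _ hj
          simp [Pi.single_apply, hj, Ne.symm hj]
        · simp
    rw [h2, ← hf, ← eval_linePoly]
    simp [pderiv_mul, pderiv_X, Pi.single_apply]
    ring

lemma hom_two {Q : MvPolynomial (Fin 2) K} (hQ : Q.IsHomogeneous 3) :
    ∃ α β γ δ : K, Q = C α * X 0 ^ 3 + C β * (X 0 ^ 2 * X 1) + C γ * (X 0 * X 1 ^ 2)
      + C δ * X 1 ^ 3 := by
  let m : ℕ → ℕ → (Fin 2 →₀ ℕ) := fun i j => Finsupp.single 0 i + Finsupp.single 1 j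
  have hm : ∀ i j, (X 0 ^ i * X 1 ^ j : MvPolynomial (Fin 2) K) = monomial (m i j) 1 := by
    intro i j
    simp [m, X_pow_eq_monomial, monomial_mul]
  have h30 := hm 3 0
  have h21 := hm 2 1
  have h12 := hm 1 2
  have h03 := hm 0 3
  simp only [pow_zero, pow_one, mul_one, one_mul] at h30 h21 h12 h03
  refine ⟨coeff (m 3 0) Q, coeff (m 2 1) Q, coeff (m 1 2) Q, coeff (m 0 3) Q, ?_⟩
  rw [h30, h21, h12, h03]
  ext d
  simp only [coeff_add, coeff_C_mul, coeff_monomial]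
  have hinj : ∀ i j, m i j = d ↔ (i = d 0 ∧ j = d 1) := by
    intro i j
    constructor
    · rintro rfl; simp [m]
    · rintro ⟨rfl, rfl⟩
      ext k; fin_cases k <;> simp [m]
  simp only [hinj]
  by_cases hd : d 0 + d 1 = 3
  · have hdd : m (d 0) (d 1) = d := (hinj _ _).2 ⟨rfl, rfl⟩
    have h4 : d 0 = 0 ∨ d 0 = 1 ∨ d 0 = 2 ∨ d 0 = 3 := by omega
    rcases h4 with h | h | h | h
    all_goals
      have h' : d 1 = 3 - d 0 := by omega
      rw [h] at h'
      rw [h, h'] at hdd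
      simp [h, h', ← hdd, m]
  · have : coeff d Q = 0 := by
      by_contra hne
      have := hQ hne
      apply hd
      rw [← this]; simp [Finsupp.weight_apply, Finsupp.sum_fintype, Fin.sum_univ_two]
    rw [this]
    have h1 : ¬ (3 = d 0 ∧ 0 = d 1) := by omega
    have h2 : ¬ (2 = d 0 ∧ 1 = d 1) := by omega
    have h3 : ¬ (1 = d 0 ∧ 2 = d 1) := by omega
    have h4 : ¬ (0 = d 0 ∧ 3 = d 1) := by omega
    simp [h1, h2, h3, h4]

lemma linePoly_eq (hP : P.IsHomogeneous 3) (a b : Fin 4 → K) :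
    linePoly K P a b = C (eval a P) * X 0 ^ 3 + C (DD P a b) * (X 0 ^ 2 * X 1)
      + C (DD P b a) * (X 0 * X 1 ^ 2) + C (eval b P) * X 1 ^ 3 := by
  have hh : (linePoly K P a b).IsHomogeneous (1 * 3) := by
    apply hP.aeval
    intro i
    have h0 := (isHomogeneous_C (Fin 2) (a i)).mul (isHomogeneous_X K (0 : Fin 2))
    have h1 := (isHomogeneous_C (Fin 2) (b i)).mul (isHomogeneous_X K (1 : Fin 2))
    simpa using h0.add h1
  obtain ⟨α, β, γ, δ, h⟩ := hom_two hh
  have e1 := eval_linePoly (P := P) a b ![1, 0]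
  have e2 := eval_linePoly (P := P) a b ![0, 1]
  have e3 := eval_pderiv_linePoly (P := P) a b ![1, 0] ![0, 1]
  have e4 := eval_pderiv_linePoly (P := P) a b ![0, 1] ![1, 0]
  rw [h] at e1 e2 e3 e4
  simp [pderiv_mul, pderiv_X, pderiv_pow, Pi.single_apply] at e1 e2 e3 e4
  rw [h, e1, e2, e3, e4]


lemma DD_lin (hP : P.IsHomogeneous 3) (a b : Fin 4 → K) (s t s' t' : K) :
    DD P (s • a + t • b) (s' • a + t' • b) =
      s' * (3 * eval a P * s ^ 2 + 2 * DD P a b * (s * t) + DD P b a * t ^ 2) +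
      t' * (3 * eval b P * t ^ 2 + 2 * DD P b a * (s * t) + DD P a b * s ^ 2) := by
  have e := eval_pderiv_linePoly (P := P) a b ![s, t] ![s', t']
  rw [linePoly_eq hP] at e
  simp [pderiv_mul, pderiv_X, pderiv_pow, Pi.single_apply] at e
  rw [← e]; ring

lemma eval_lin (hP : P.IsHomogeneous 3) (a b : Fin 4 → K) (s t : K) :
    eval (s • a + t • b) P = eval a P * s ^ 3 + DD P a b * (s ^ 2 * t) +
      DD P b a * (s * t ^ 2) + eval b P * t ^ 3 := by
  have e := eval_linePoly (P := P) a b ![s, t]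
  rw [linePoly_eq hP] at e
  simpa using e.symm

lemma reg_mk (hP : P.IsHomogeneous 3) {w : Fin 4 → K} (hw : w ≠ 0) (h0 : eval w P = 0)
    (v : Fin 4 → K) (hD : DD P w v ≠ 0) : ∃ z : Reg K P, z.1 = Projectivization.mk K w hw := by
  obtain ⟨c, hc⟩ := Projectivization.exists_smul_eq_mk_rep K w hw
  refine ⟨⟨Projectivization.mk K w hw, ?_, ?_⟩, rfl⟩
  · rw [← hc, Units.smul_def, eval_hom hP, h0, mul_zero]
  · rw [← hc, Units.smul_def]
    by_contra hcon
    push Not at hcon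
    have h1 : DD P ((c : K) • w) v = 0 := by simp [DD, hcon]
    have h2 := DD_lin hP w v c 0 0 1
    simp [h1] at h2
    exact hD h2

lemma li_rep {x y : Pt K} (h : x ≠ y) : LinearIndependent K ![x.rep, y.rep] :=
  Projectivization.linearIndependent_pair_iff_ne.2 h

lemma exists_third (hP : P.IsHomogeneous 3) (x y : Reg K P) (hxy : x ≠ y)
    (hy : ¬ OnLineInV K P y.1) : ∃ z : Reg K P, Col K P (fun i => (![x, y, z] i).1) := by
  have hne : x.1 ≠ y.1 := fun h => hxy (Subtype.ext h)
  have hli := li_rep hne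
  have hx0 := x.2.1
  have hy0 := y.2.1
  have hxm : ∃ h : x.1.rep ≠ 0, Projectivization.mk K x.1.rep h = x.1 :=
    ⟨_, Projectivization.mk_rep x.1⟩
  have hym : ∃ h : y.1.rep ≠ 0, Projectivization.mk K y.1.rep h = y.1 :=
    ⟨_, Projectivization.mk_rep y.1⟩
  generalize x.1.rep = a at *
  obtain ⟨hxn, hxm⟩ := hxm
  generalize y.1.rep = b at *
  obtain ⟨hyn, hym⟩ := hym
  have hL := linePoly_eq hP a b
  rw [hx0, hy0] at hL
  have hli' := LinearIndependent.pair_iff.1 hli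
  have hnz : ¬ (DD P a b = 0 ∧ DD P b a = 0) := by
    rintro ⟨h1, h2⟩
    apply hy
    refine ⟨a, b, hli, ?_, 0, 1, by simpa using hyn, ?_⟩
    · rw [hL, h1, h2]; simp
    · simpa using hym
  have hw : (-DD P b a) • a + DD P a b • b ≠ 0 := by
    intro h
    have := hli' _ _ h
    exact hnz ⟨this.2, by simpa using this.1⟩
  have key : ∃ z : Reg K P, z.1 = Projectivization.mk K _ hw := by
    by_cases h1 : DD P a b = 0
    · refine ⟨x, ?_⟩
      rw [← hxm]
      rw [Projectivization.mk_eq_mk_iff']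
      have h2 : DD P b a ≠ 0 := fun h => hnz ⟨h1, h⟩
      refine ⟨-(DD P b a)⁻¹, ?_⟩
      rw [h1]; simp [smul_smul, h2]
    by_cases h2 : DD P b a = 0
    · refine ⟨y, ?_⟩
      rw [← hym]
      rw [Projectivization.mk_eq_mk_iff']
      refine ⟨(DD P a b)⁻¹, ?_⟩
      rw [h2]; simp [smul_smul, h1]
    refine reg_mk hP hw ?_ ((0 : K) • a + (1 : K) • b) ?_
    · rw [eval_lin hP, hx0, hy0]; ring
    · rw [DD_lin hP, hx0, hy0]
      have : (DD P b a) ^ 2 * DD P a b ≠ 0 := mul_ne_zero (pow_ne_zero _ h2) h1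
      intro h
      apply this
      linear_combination -h
  obtain ⟨z, hz⟩ := key
  refine ⟨z, a, b, hli, -1, by simp, ![1, 0, -DD P b a], ![0, 1, DD P a b], ?_, ?_⟩
  · intro i
    fin_cases i
    · exact ⟨by simpa using hxn, by simpa using hxm⟩
    · exact ⟨by simpa using hyn, by simpa using hym⟩
    · exact ⟨by simpa using hw, by simpa using hz.symm⟩
  · rw [hL]
    simp [Fin.prod_univ_three]
    ring

lemma third_eq {x y z : Pt K} (hyz : y ≠ z)
    (h : Col K P ![x, y, z]) : ∃ c : K, c • x.rep = 
      (-DD P z.rep y.rep) • y.rep + DD P y.rep z.rep • z.rep ∧ c ≠ 0 := by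
  obtain ⟨a, b, hli, c, hc, s, t, hpt, hL⟩ := h
  obtain ⟨h0, hx⟩ := hpt 0
  obtain ⟨h1, hy⟩ := hpt 1
  obtain ⟨h2, hz⟩ := hpt 2
  simp at hx hy hz
  obtain ⟨k, hk⟩ := Projectivization.exists_smul_eq_mk_rep K _ h0
  obtain ⟨l, hl⟩ := Projectivization.exists_smul_eq_mk_rep K _ h1
  obtain ⟨m, hm⟩ := Projectivization.exists_smul_eq_mk_rep K _ h2
  rw [hx] at hk
  rw [hy] at hl
  rw [hz] at hm
  rw [← hk, ← hl, ← hm]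
  simp only [Units.smul_def]
  have hΔ : s 1 * t 2 - s 2 * t 1 ≠ 0 := by
    intro hΔ
    apply hyz
    rw [← hy, ← hz, Projectivization.mk_eq_mk_iff']
    by_cases hs : s 2 = 0
    · have ht : t 2 ≠ 0 := by
        intro ht; apply h2; simp [hs, ht]
      refine ⟨t 1 / t 2, ?_⟩
      have h3 : s 1 = 0 := by
        have : s 1 * t 2 = 0 := by simpa [hs] using hΔ
        simpa [ht] using this
      simp [hs, h3, smul_smul, ht]
    · refine ⟨s 1 / s 2, ?_⟩
      have h3 : s 1 / s 2 * t 2 = t 1 := by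
        field_simp; linear_combination hΔ
      simp only [smul_add, smul_smul, h3]
      field_simp
  have D1 := eval_pderiv_linePoly (P := P) a b ![l * s 1, l * t 1] ![m * s 2, m * t 2]
  have D2 := eval_pderiv_linePoly (P := P) a b ![m * s 2, m * t 2] ![l * s 1, l * t 1]
  rw [hL] at D1 D2
  simp [pderiv_mul, pderiv_X, Fin.prod_univ_three] at D1 D2
  simp only [smul_add, smul_smul]
  rw [← D1, ← D2]
  refine ⟨-(l ^ 2 * m ^ 2 * c * (s 1 * t 2 - s 2 * t 1) ^ 3 / k), ?_, ?_⟩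
  · have hk0 : (k : K) ≠ 0 := k.ne_zero
    ext i
    simp only [Pi.add_apply, Pi.smul_apply, smul_eq_mul]
    field_simp
    ring
  · have := k.ne_zero
    have := l.ne_zero
    have := m.ne_zero
    simp only [ne_eq, neg_eq_zero, div_eq_zero_iff, mul_eq_zero, pow_eq_zero_iff, not_or]
    simp [hc, hΔ]

lemma third_unique {x x' y z : Reg K P} (hyz : z ≠ y)
    (h : Col K P (fun i => (![x, y, z] i).1)) (h' : Col K P (fun i => (![x', y, z] i).1)) :
    x = x' := by
  have e : ∀ x : Reg K P, (fun i => (![x, y, z] i).1) = ![x.1, y.1, z.1] := by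
    intro x; ext i; fin_cases i <;> rfl
  rw [e] at h h'
  have hne : y.1 ≠ z.1 := fun h => hyz (Subtype.ext h.symm)
  obtain ⟨c, hc, hc0⟩ := third_eq hne h
  obtain ⟨d, hd, hd0⟩ := third_eq hne h'
  apply Subtype.ext
  rw [← Projectivization.mk_rep x.1, ← Projectivization.mk_rep x'.1,
    Projectivization.mk_eq_mk_iff']
  refine ⟨c⁻¹ * d, ?_⟩
  rw [mul_smul, hd, ← hc, smul_smul, inv_mul_cancel₀ hc0, one_smul]

lemma tangent_line (hP : P.IsHomogeneous 3) (y : Reg K P) (hy : ¬ OnLineInV K P y.1)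
    (a : Fin 4 → K) (hD : DD P y.1.rep a = 0) (hli : LinearIndependent K ![y.1.rep, a]) :
    ∃ z : Reg K P, Col K P (fun i => (![y, y, z] i).1) ∧
      ∃ s t : K, ∃ h : s • y.1.rep + t • a ≠ 0, z.1 = Projectivization.mk K _ h := by
  have hy0 := y.2.1
  have hym : ∃ h : y.1.rep ≠ 0, Projectivization.mk K y.1.rep h = y.1 :=
    ⟨_, Projectivization.mk_rep y.1⟩
  generalize y.1.rep = b at *
  obtain ⟨hyn, hym⟩ := hym
  have hL := linePoly_eq hP b a
  rw [hy0, hD] at hL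
  have hli' := LinearIndependent.pair_iff.1 hli
  have hnz : ¬ (DD P a b = 0 ∧ eval a P = 0) := by
    rintro ⟨h1, h2⟩
    apply hy
    refine ⟨b, a, hli, ?_, 1, 0, by simpa using hyn, ?_⟩
    · rw [hL, h1, h2]; simp
    · simpa using hym
  have hw : (-eval a P) • b + DD P a b • a ≠ 0 := by
    intro h
    have := hli' _ _ h
    exact hnz ⟨this.2, by simpa using this.1⟩
  have key : ∃ z : Reg K P, z.1 = Projectivization.mk K _ hw := by
    by_cases h1 : DD P a b = 0
    · refine ⟨y, ?_⟩
      rw [← hym]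
      rw [Projectivization.mk_eq_mk_iff']
      have h2 : eval a P ≠ 0 := fun h => hnz ⟨h1, h⟩
      refine ⟨-(eval a P)⁻¹, ?_⟩
      rw [h1]; simp [smul_smul, h2]
    refine reg_mk hP hw ?_ ((1 : K) • b + (0 : K) • a) ?_
    · rw [eval_lin hP, hy0, hD]; ring
    · rw [DD_lin hP, hy0, hD]
      have : DD P a b ^ 3 ≠ 0 := pow_ne_zero _ h1
      intro h
      apply this
      linear_combination h
  obtain ⟨z, hz⟩ := key
  refine ⟨z, ?_, _, _, hw, hz⟩
  refine ⟨b, a, hli, 1, by simp, ![1, 1, -eval a P], ![0, 0, DD P a b], ?_, ?_⟩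
  · intro i
    fin_cases i
    · exact ⟨by simpa using hyn, by simpa using hym⟩
    · exact ⟨by simpa using hyn, by simpa using hym⟩
    · exact ⟨by simpa using hw, by simpa using hz.symm⟩
  · rw [hL]
    simp [Fin.prod_univ_three]
    ring

lemma tangent_pts (hP : P.IsHomogeneous 3) (y : Reg K P) (hy : ¬ OnLineInV K P y.1) :
    ∃ z w : Reg K P, Col K P (fun i => (![y, y, z] i).1) ∧
      Col K P (fun i => (![y, y, w] i).1) ∧ (z = w → z = y) := by
  have hyn := Projectivization.rep_nonzero y.1
  have hym := Projectivization.mk_rep y.1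
  let φ : (Fin 4 → K) →ₗ[K] K :=
    { toFun := fun v => DD P y.1.rep v
      map_add' := by intro u v; simp [DD, add_mul, Finset.sum_add_distrib]
      map_smul' := by intro c v; simp [DD, Finset.mul_sum, mul_assoc] }
  have hdim : 3 ≤ Module.finrank K (LinearMap.ker φ) := by
    have h1 := LinearMap.finrank_range_add_finrank_ker φ
    have h2 := Submodule.finrank_le (LinearMap.range φ)
    simp at h1 h2
    omega
  have hex : ∀ S : Finset (Fin 4 → K), S.card < 3 →
      ∃ a, φ a = 0 ∧ a ∉ Submodule.span K (S : Set (Fin 4 → K)) := by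
    intro S hS
    by_contra hcon
    push Not at hcon
    have hle : LinearMap.ker φ ≤ Submodule.span K (S : Set (Fin 4 → K)) := hcon
    have := Submodule.finrank_mono hle
    have h3 := finrank_span_finset_le_card (R := K) S
    unfold Set.finrank at h3
    omega
  classical
  obtain ⟨a, ha, ha'⟩ := hex {y.1.rep} (by simp)
  obtain ⟨b, hb, hb'⟩ := hex {y.1.rep, a} (lt_of_le_of_lt Finset.card_le_two (by simp))
  simp [Submodule.mem_span_singleton] at ha'
  simp [Submodule.mem_span_pair] at hb'
  have hla : LinearIndependent K ![y.1.rep, a] := (LinearIndependent.pair_iff' hyn).2 ha'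
  have hlb : LinearIndependent K ![y.1.rep, b] := (LinearIndependent.pair_iff' hyn).2
    (fun c => by simpa using hb' c 0)
  obtain ⟨z, hz, s, t, h, hzm⟩ := tangent_line hP y hy a ha hla
  obtain ⟨w, hw, s', t', h', hwm⟩ := tangent_line hP y hy b hb hlb
  refine ⟨z, w, hz, hw, ?_⟩
  intro hzw
  rw [← hzw, hzm, Projectivization.mk_eq_mk_iff] at hwm
  obtain ⟨c, hc⟩ := hwm
  rw [Units.smul_def] at hc
  have hc0 := c.ne_zero
  have ht' : t' = 0 := by
    by_contra ht'
    apply hb' ((c * t')⁻¹ * (s - c * s')) ((c * t')⁻¹ * t)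
    have : ((c : K) * t') • b = (s - c * s') • y.1.rep + t • a := by
      simp only [smul_add, smul_smul] at hc
      rw [sub_smul, ← sub_eq_zero]
      rw [← sub_eq_zero] at hc
      rw [← hc]
      abel
    rw [mul_smul, mul_smul, ← smul_add, ← this, smul_smul, inv_mul_cancel₀, one_smul]
    exact mul_ne_zero hc0 ht'
  subst ht'
  apply Subtype.ext
  refine (hzm.trans ?_).trans hym
  rw [Projectivization.mk_eq_mk_iff']
  refine ⟨c * s', ?_⟩
  rw [← hc]; simp [smul_smul]

end Aux

lemma comb3 {R : Type*} [Finite R] (f : R → ZMod 3) (T : R → R → R → Prop) (good : R → Prop)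
    (γ : ZMod 3) (hT : ∀ x y z, T x y z → f x + f y + f z = γ)
    (h1 : ∀ x y, x ≠ y → good y → ∃ z, T x y z)
    (h2 : ∀ x x' y z, z ≠ y → T x y z → T x' y z → x = x')
    (h3 : ∀ y, good y → ∃ z w, T y y z ∧ T y y w ∧ (z = w → z = y))
    (hg : ∀ x, ∃ y, f x = f y ∧ good y) (hnc : ∃ x y, f x ≠ f y) :
    ∃ n : ℕ, 0 < n ∧ ∀ i, (f ⁻¹' {i}).ncard = n := by
  have hpos : ∀ i, 0 < (f ⁻¹' {i}).ncard ↔ ∃ x, f x = i := by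
    intro i
    rw [Set.ncard_pos (Set.toFinite _)]
    rfl
  have hG : ∀ y, good y → ∃ g : R → R, ∀ x, T x y (g x) := by
    intro y hy
    have : ∀ x, ∃ z, T x y z := by
      intro x
      by_cases hxy : x = y
      · obtain ⟨z, w, hz, _⟩ := h3 y hy
        exact ⟨z, hxy ▸ hz⟩
      · exact h1 x y hxy hy
    choose g hg using this
    exact ⟨g, hg⟩
  have hA : ∀ i j k, (∃ x, f x = j) → i + j + k = γ → k ≠ j →
      (f ⁻¹' {i}).ncard ≤ (f ⁻¹' {k}).ncard := by
    rintro i j k ⟨x, rfl⟩ hs hk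
    obtain ⟨y, hxy, hy⟩ := hg x
    obtain ⟨g, hgT⟩ := hG y hy
    have hfg : ∀ u, f u = i → f (g u) = k := by
      intro u hu
      have := hT _ _ _ (hgT u)
      rw [hu, ← hxy, ← hs] at this
      exact add_left_cancel this
    have hne : ∀ u, f u = i → g u ≠ y := by
      intro u hu h
      apply hk
      rw [hxy, ← h, hfg u hu]
    refine Set.ncard_le_ncard_of_injOn g (fun u hu => hfg u hu) ?_ (Set.toFinite _)
    intro u hu v hv huv
    exact h2 u v y (g u) (hne u hu) (hgT u) (huv ▸ hgT v)
  have hB : ∀ j k, (∃ x, f x = j) → j + j + k = γ → k ≠ j →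
      (f ⁻¹' {j}).ncard < (f ⁻¹' {k}).ncard := by
    rintro j k ⟨x, rfl⟩ hs hk
    obtain ⟨y, hxy, hy⟩ := hg x
    obtain ⟨g, hgT⟩ := hG y hy
    have hfg : ∀ u z, f u = f x → T u y z → f z = k := by
      intro u z hu hz
      have := hT _ _ _ hz
      rw [hu, ← hxy, ← hs] at this
      exact add_left_cancel this
    have hne : ∀ u z, f u = f x → T u y z → z ≠ y := by
      intro u z hu hz h
      apply hk
      rw [hxy, ← h, hfg u z hu hz]
    obtain ⟨z, w, hz, hw, hzw⟩ := h3 y hy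
    have hzw' : z ≠ w := fun h => hne y z hxy.symm hz (hzw h)
    have hinj : Set.InjOn g (f ⁻¹' {f x}) := by
      intro u hu v hv huv
      exact h2 u v y (g u) (hne u _ hu (hgT u)) (hgT u) (huv ▸ hgT v)
    rw [← Set.ncard_image_of_injOn hinj]
    apply Set.ncard_lt_ncard _ (Set.toFinite _)
    rw [Set.ssubset_iff_subset_ne]
    constructor
    · rintro _ ⟨u, hu, rfl⟩
      exact hfg u _ hu (hgT u)
    · intro heq
      have hz' : z ∈ g '' (f ⁻¹' {f x}) := by
        rw [heq]; exact hfg y z hxy.symm hz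
      have hw' : w ∈ g '' (f ⁻¹' {f x}) := by
        rw [heq]; exact hfg y w hxy.symm hw
      obtain ⟨u, hu, huz⟩ := hz'
      obtain ⟨v, hv, hvw⟩ := hw'
      have e1 : u = y := h2 u y y z (hne _ _ hxy.symm hz) (huz ▸ hgT u) hz
      have e2 : v = y := h2 v y y w (hne _ _ hxy.symm hw) (hvw ▸ hgT v) hw
      apply hzw'
      rw [← huz, ← hvw, e1, e2]
  obtain ⟨x, x', hxx⟩ := hnc
  by_cases hγ : γ = 0
  · subst hγ
    have hE : ∀ j, (∃ x, f x = j) → (f ⁻¹' {j + 1}).ncard = (f ⁻¹' {j + 2}).ncard := by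
      intro j hj
      apply le_antisymm
      · exact hA _ j _ hj (by clear hj; revert j; decide) (by clear hj; revert j; decide)
      · exact hA _ j _ hj (by clear hj; revert j; decide) (by clear hj; revert j; decide)
    have a1 := hE _ ⟨x, rfl⟩
    have a2 := hE _ ⟨x', rfl⟩
    have a3 := (hpos _).2 ⟨x, rfl⟩
    refine ⟨_, a3, ?_⟩
    generalize f x = j at *
    generalize f x' = j' at *
    clear a3
    generalize hm : (fun i => (f ⁻¹' {i}).ncard) = m at *
    have hm' : ∀ i, (f ⁻¹' {i}).ncard = m i := fun i => by rw [← hm]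
    simp only [hm'] at *
    have c : ∀ j : ZMod 3, j = 0 ∨ j = 1 ∨ j = 2 := by decide
    have e1 : (1 + 1 : ZMod 3) = 2 := by decide
    have e2 : (1 + 2 : ZMod 3) = 0 := by decide
    have e3 : (2 + 1 : ZMod 3) = 0 := by decide
    have e4 : (2 + 2 : ZMod 3) = 1 := by decide
    intro i
    rcases c j with rfl | rfl | rfl <;> rcases c j' with rfl | rfl | rfl <;>
      rcases c i with rfl | rfl | rfl <;>
      simp only [zero_add, e1, e2, e3, e4] at a1 a2 <;> first | exact absurd rfl hxx | omega
  · exfalso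
    have z1 : ∀ j γ : ZMod 3, j + j + (j + γ) = γ := by decide
    have z2 : ∀ j γ : ZMod 3, ¬ γ = 0 → j + γ ≠ j := by decide
    have z3 : ∀ j γ : ZMod 3, j + γ + γ + γ = j := by decide
    have hS : ∀ j, (∃ x, f x = j) → (f ⁻¹' {j}).ncard < (f ⁻¹' {j + γ}).ncard := by
      intro j hj
      exact hB _ _ hj (z1 j γ) (z2 j γ hγ)
    have b1 := hS _ ⟨x, rfl⟩
    have b2 := hS _ ((hpos _).1 (lt_of_le_of_lt (Nat.zero_le _) b1))
    have b3 := hS _ ((hpos _).1 (lt_of_le_of_lt (Nat.zero_le _) b2))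
    have e : f x + γ + γ + γ = f x := by
      exact z3 _ _
    rw [e] at b3
    omega

lemma MW_triv {K : Type*} [Field K] {P : MvPolynomial (Fin 4) K}
    (h : ∀ x y : Reg K P, EquivPt K P x y) : MW K P = ⊥ := by
  have he : ∃ e : FreeAbelianGroup (Reg K P) ⧸ Nsub K P,
      ∀ x, QuotientAddGroup.mk' (Nsub K P) (of x) = e := by
    by_cases hne : Nonempty (Reg K P)
    · obtain ⟨y⟩ := hne
      refine ⟨QuotientAddGroup.mk' (Nsub K P) (of y), fun x => ?_⟩
      rw [← sub_eq_zero, ← map_sub, QuotientAddGroup.mk'_apply, QuotientAddGroup.eq_zero_iff]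
      exact h x y
    · exact ⟨0, fun x => (hne ⟨x⟩).elim⟩
  obtain ⟨e, he⟩ := he
  have hall : ∀ g, QuotientAddGroup.mk' (Nsub K P) g = aug K P g • e := by
    intro g
    induction g using FreeAbelianGroup.induction_on with
    | zero => simp
    | of x => rw [he]; simp [aug]
    | neg x hx => rw [map_neg, hx, map_neg, neg_smul]
    | add x y hx hy => rw [map_add, hx, hy, map_add, add_smul]
  rw [eq_bot_iff]
  rintro _ ⟨g, hg, rfl⟩
  have : aug K P g = 0 := hg
  rw [AddSubgroup.mem_bot, hall, this, zero_smul]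

instance {K : Type*} [Field K] [Finite K] (P : MvPolynomial (Fin 4) K) : Finite (Reg K P) := by
  have : Finite (Pt K) := Quotient.finite _
  exact Subtype.finite

lemma exists_label {K : Type*} [Field K] {P : MvPolynomial (Fin 4) K}
    (hMW : Nat.card ↥(MW K P) = 3) (y0 : Reg K P) :
    ∃ f : Reg K P → ZMod 3, (∀ x y, EquivPt K P x y ↔ f x = f y) ∧
      ∀ x y : Fin 3 → Reg K P, Col K P (fun i => (x i).1) → Col K P (fun i => (y i).1) →
        f (x 0) + f (x 1) + f (x 2) = f (y 0) + f (y 1) + f (y 2) := by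
  haveI : Fact (Nat.Prime 3) := ⟨Nat.prime_three⟩
  have hcyc : IsAddCyclic ↥(MW K P) := isAddCyclic_of_prime_card hMW
  have e0 := zmodAddCyclicAddEquiv hcyc
  rw [hMW] at e0
  let e := e0.symm
  have hmem : ∀ x, QuotientAddGroup.mk' (Nsub K P) (of x - of y0) ∈ MW K P := by
    intro x
    refine ⟨of x - of y0, ?_, rfl⟩
    show aug K P _ = 0
    simp [aug]
  refine ⟨fun x => e ⟨_, hmem x⟩, ?_, ?_⟩
  · intro x y
    rw [e.injective.eq_iff, Subtype.mk.injEq, ← sub_eq_zero, ← map_sub, QuotientAddGroup.mk'_apply,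
      QuotientAddGroup.eq_zero_iff, sub_sub_sub_cancel_right]
    rfl
  · intro x y hx hy
    simp only [← map_add]
    congr 1
    apply Subtype.ext
    simp only [AddSubgroup.coe_add, ← map_add]
    rw [← sub_eq_zero, ← map_sub, QuotientAddGroup.mk'_apply, QuotientAddGroup.eq_zero_iff]
    apply AddSubgroup.subset_closure
    refine ⟨x, y, hx, hy, ?_⟩
    abel


/-- let `V ⊂ P³` be a cubic surface over the finite field `F_q`.  Suppose
that every equivalence class of `V^reg(F_q)` contains a point lying on no line contained
in `V`, and that `MW(V)` has exactly three elements.  Then `V^reg(F_q)` decomposes into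
exactly three equivalence classes `M₀`, `M₁`, `M₂` of the same cardinality. -/
theorem three_classes_equal_size (K : Type*) [Field K] [Fintype K]
    (P : MvPolynomial (Fin 4) K) (hP : P ≠ 0) (hhom : P.IsHomogeneous 3)
    (hrep : ∀ x : Reg K P, ∃ y : Reg K P, EquivPt K P x y ∧ ¬ OnLineInV K P y.1)
    (hMW : Nat.card ↥(MW K P) = 3) :
    ∃ M₀ M₁ M₂ : Set (Reg K P), M₀.Nonempty ∧ M₁.Nonempty ∧ M₂.Nonempty ∧
      Disjoint M₀ M₁ ∧ Disjoint M₀ M₂ ∧ Disjoint M₁ M₂ ∧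
      M₀ ∪ M₁ ∪ M₂ = Set.univ ∧
      (∀ x y : Reg K P,
        EquivPt K P x y ↔
          ((x ∈ M₀ ∧ y ∈ M₀) ∨ (x ∈ M₁ ∧ y ∈ M₁) ∨ (x ∈ M₂ ∧ y ∈ M₂))) ∧
      M₀.ncard = M₁.ncard ∧ M₁.ncard = M₂.ncard := by
  have hnt : ∃ x y : Reg K P, ¬ EquivPt K P x y := by
    by_contra hcon
    push Not at hcon
    rw [MW_triv hcon] at hMW
    simp at hMW
  obtain ⟨x0, x1, hx01⟩ := hnt
  obtain ⟨y0, -, hy0⟩ := hrep x0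
  obtain ⟨f, hf, hcol⟩ := exists_label hMW y0
  obtain ⟨z0, -, hz0, -⟩ := tangent_pts hhom y0 hy0
  obtain ⟨n, hn, hcard⟩ := comb3 f (fun x y z => Col K P (fun i => (![x, y, z] i).1))
    (fun y => ¬ OnLineInV K P y.1) (f y0 + f y0 + f z0)
    (fun x y z h => hcol ![x, y, z] ![y0, y0, z0] h hz0)
    (fun x y hxy hy => exists_third hhom x y hxy hy)
    (fun x x' y z hzy h h' => third_unique hzy h h')
    (fun y hy => tangent_pts hhom y hy)
    (fun x => by
      obtain ⟨y, h, hy⟩ := hrep x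
      exact ⟨y, (hf x y).1 h, hy⟩)
    ⟨x0, x1, fun h => hx01 ((hf _ _).2 h)⟩
  have hne : ∀ i, (f ⁻¹' {i}).Nonempty := fun i =>
    Set.nonempty_of_ncard_ne_zero (by rw [hcard i]; omega)
  have hdis : ∀ i j : ZMod 3, i ≠ j → Disjoint (f ⁻¹' {i}) (f ⁻¹' {j}) := fun i j hij =>
    Disjoint.preimage f (by simpa using hij)
  have c : ∀ j : ZMod 3, j = 0 ∨ j = 1 ∨ j = 2 := by decide
  refine ⟨f ⁻¹' {0}, f ⁻¹' {1}, f ⁻¹' {2}, hne _, hne _, hne _, hdis _ _ (by decide),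
    hdis _ _ (by decide), hdis _ _ (by decide), ?_, ?_, by rw [hcard, hcard], by rw [hcard, hcard]⟩
  · ext x
    rcases c (f x) with h | h | h <;> simp [h]
  · intro x y
    rw [hf]
    simp only [Set.mem_preimage, Set.mem_singleton_iff]
    generalize f x = i
    generalize f y = j
    revert i j
    decide
end
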